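/- Let d be an odd prime. The phase-space point operators A(m), m ∈ (ZMod d)², are orthogonal with respect to the Hilbert–Schmidt inner product and resolve the identity: Tr(A(m)·A(m')) = d if m = m' and 0 otherwise, and Σ_{m ∈ (ZMod d)²} A(m) = d · 𝟙, where 𝟙 is the d × d identity matrix. -/

import Mathlib

open Matrix

/-- The additive character `χ(c) = exp(2πi·c̃/d)`, where `c̃` is the canonical
integer representative of `c : ZMod d`. -/
noncomputable def chi (d : ℕ) (c : ZMod d) : ℂ :=
  Complex.exp (2 * Real.pi * Complex.I * (c.val : ℂ) / (d : ℂ))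

/-- The shift matrix `S(q)`, with entries `S(q)_{x,y} = 1` if `x = y − q` and `0` otherwise. -/
def shiftM (d : ℕ) (q : ZMod d) : Matrix (ZMod d) (ZMod d) ℂ :=
  Matrix.of fun x y => if x = y - q then 1 else 0

/-- The boost matrix `B(p)`, with entries `B(p)_{x,y} = χ(x·p)` if `x = y` and `0` otherwise. -/
noncomputable def boostM (d : ℕ) (p : ZMod d) : Matrix (ZMod d) (ZMod d) ℂ :=
  Matrix.of fun x y => if x = y then chi d (x * p) else 0

/-- The symplectic inner product `⟨a,a'⟩ = q·p' − p·q'` on `(ZMod d)²`. -/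
def sympIP {d : ℕ} (a a' : ZMod d × ZMod d) : ZMod d :=
  a.1 * a'.2 - a.2 * a'.1

/-- The phased Weyl operator `W(q,p) = χ(−2⁻¹·q·p) · S(q)·B(p)`,
where `2⁻¹` is the multiplicative inverse of `2` in `ZMod d`. -/
noncomputable def weylPh (d : ℕ) [NeZero d] (a : ZMod d × ZMod d) :
    Matrix (ZMod d) (ZMod d) ℂ :=
  chi d (-((2 : ZMod d)⁻¹ * a.1 * a.2)) • (shiftM d a.1 * boostM d a.2)

/-- The phase-space point operator `A(m) = (1/d) · Σ_{m'} χ(⟨m,m'⟩) · W(m')`. -/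
noncomputable def pointOp (d : ℕ) [NeZero d] (m : ZMod d × ZMod d) :
    Matrix (ZMod d) (ZMod d) ℂ :=
  (d : ℂ)⁻¹ • ∑ m' : ZMod d × ZMod d, chi d (sympIP m m') • weylPh d m'

theorem chi_eq_stdAddChar (d : ℕ) [NeZero d] (c : ZMod d) :
    chi d c = ZMod.stdAddChar c := by
  rw [ZMod.stdAddChar_apply, ZMod.toCircle_apply, chi]

theorem chi_add (d : ℕ) [NeZero d] (a b : ZMod d) : chi d (a + b) = chi d a * chi d b := by
  simp only [chi_eq_stdAddChar, AddChar.map_add_eq_mul]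

theorem sum_chi_mul (d : ℕ) [NeZero d] (b : ZMod d) :
    ∑ x : ZMod d, chi d (x * b) = if b = 0 then (d : ℂ) else 0 := by
  simp only [chi_eq_stdAddChar]
  have h := AddChar.sum_mulShift b (ZMod.isPrimitive_stdAddChar d)
  rw [ZMod.card] at h
  rw [h]
  split_ifs <;> simp

theorem weylPh_apply (d : ℕ) [NeZero d] (q p x y : ZMod d) :
    weylPh d (q, p) x y =
      if q = y - x then chi d (-((2 : ZMod d)⁻¹ * q * p) + y * p) else 0 := by
  have h : x = y - q ↔ q = y - x := by constructor <;> rintro rfl <;> ring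
  simp [weylPh, shiftM, boostM, Matrix.mul_apply, chi_add, h]

theorem ZMod.two_mul_inv_two {d : ℕ} (hodd : Odd d) : (2 : ZMod d) * 2⁻¹ = 1 := by
  exact_mod_cast ZMod.coe_mul_inv_eq_one 2 (Nat.coprime_two_left.mpr hodd)

/-- The point operator `A(m)` is, up to phases, the reflection `x ↦ -2 m₁ - x`. -/
theorem pointOp_apply (d : ℕ) [NeZero d] (hodd : Odd d) (m : ZMod d × ZMod d) (x y : ZMod d) :
    pointOp d m x y =
      if m.1 = -((2 : ZMod d)⁻¹ * (x + y)) then chi d (m.2 * (x - y)) else 0 := by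
  have h2 := ZMod.two_mul_inv_two hodd
  have hd : (d : ℂ) ≠ 0 := Nat.cast_ne_zero.mpr (NeZero.ne d)
  have hphase (p : ZMod d) :
      chi d (sympIP m (y - x, p)) * chi d (-((2 : ZMod d)⁻¹ * (y - x) * p) + y * p) =
        chi d (m.2 * (x - y)) * chi d (p * (m.1 + (2 : ZMod d)⁻¹ * (x + y))) := by
    rw [← chi_add, ← chi_add]
    congr 1
    simp only [sympIP]
    linear_combination -(y * p) * h2
  have hsum : pointOp d m x y = (d : ℂ)⁻¹ * ∑ p : ZMod d,
      chi d (m.2 * (x - y)) * chi d (p * (m.1 + (2 : ZMod d)⁻¹ * (x + y))) := by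
    simp only [← hphase, pointOp, Matrix.smul_apply, Matrix.sum_apply, smul_eq_mul,
      Fintype.sum_prod_type_right, weylPh_apply, mul_ite, mul_zero, Finset.sum_ite_eq',
      Finset.mem_univ, if_true]
  rw [hsum, ← Finset.mul_sum, sum_chi_mul]
  simp only [add_eq_zero_iff_eq_neg]
  split_ifs
  · field_simp
  · simp

theorem trace_pointOp_mul_pointOp (d : ℕ) [NeZero d] (hodd : Odd d) (m m' : ZMod d × ZMod d) :
    Matrix.trace (pointOp d m * pointOp d m') = if m = m' then (d : ℂ) else 0 := by
  have h2 := ZMod.two_mul_inv_two hodd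
  have hentry (x y : ZMod d) : pointOp d m x y * pointOp d m' y x =
      if y = -(2 * m.1) - x then
        if m.1 = m'.1 then
          chi d (2 * (m.1 * (m.2 - m'.2))) * chi d (x * (2 * (m.2 - m'.2))) else 0
      else 0 := by
    have hy : m.1 = -((2 : ZMod d)⁻¹ * (x + y)) ↔ y = -(2 * m.1) - x := by
      constructor <;> intro h
      · linear_combination 2 * h - (x + y) * h2
      · rw [h]; linear_combination -m.1 * h2
    rw [pointOp_apply d hodd, pointOp_apply d hodd, add_comm y x]
    by_cases hm : m.1 = -((2 : ZMod d)⁻¹ * (x + y))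
    · rw [if_pos hm, if_pos (hy.mp hm), ← hm, mul_ite, mul_zero, ← chi_add, ← chi_add]
      simp only [eq_comm (a := m'.1)]
      congr 2
      linear_combination (m'.2 - m.2) * hy.mp hm
    · rw [if_neg hm, if_neg (mt hy.mpr hm), zero_mul]
  have hfactor : 2 * (m.2 - m'.2) = 0 ↔ m.2 = m'.2 := by
    constructor <;> intro h
    · linear_combination (2 : ZMod d)⁻¹ * h - (m.2 - m'.2) * h2
    · rw [h]; ring
  simp only [Matrix.trace, Matrix.diag_apply, Matrix.mul_apply, hentry, Finset.sum_ite_eq',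
    Finset.mem_univ, if_true]
  by_cases h₁ : m.1 = m'.1
  · simp only [h₁, if_true, ← Finset.mul_sum, sum_chi_mul, hfactor, Prod.ext_iff, true_and]
    split_ifs with h
    · simp [h, chi]
    · simp
  · simp [h₁, Prod.ext_iff]

theorem sum_pointOp (d : ℕ) [NeZero d] (hodd : Odd d) :
    ∑ m : ZMod d × ZMod d, pointOp d m = (d : ℂ) • (1 : Matrix (ZMod d) (ZMod d) ℂ) := by
  ext x y
  simp only [Matrix.sum_apply, pointOp_apply d hodd, Fintype.sum_prod_type_right,
    Finset.sum_ite_eq', Finset.mem_univ, if_true, sum_chi_mul, sub_eq_zero, Matrix.smul_apply,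
    Matrix.one_apply, smul_eq_mul, mul_ite, mul_one, mul_zero]

theorem stmt_18 (d : ℕ) [NeZero d] (hp : d.Prime) (hodd : Odd d) :
    -- Hilbert–Schmidt orthogonality
    (∀ m m' : ZMod d × ZMod d,
      Matrix.trace (pointOp d m * pointOp d m') = if m = m' then (d : ℂ) else 0) ∧
    -- resolution of the identity
    (∑ m : ZMod d × ZMod d, pointOp d m = (d : ℂ) • (1 : Matrix (ZMod d) (ZMod d) ℂ)) :=
  ⟨trace_pointOp_mul_pointOp d hodd, sum_pointOp d hodd⟩
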